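/- Let R be a commutative ring. Let P be an a × a matrix over R and Q a b × b matrix over R, and suppose the cokernels R^a/(range of P) and R^b/(range of Q) are isomorphic as R-modules. Then the principal ideal of R generated by det P equals the principal ideal generated by det Q. -/

import Mathlib

namespace Matrix

theorem exists_eq_mul_of_range_le {R : Type*} [CommRing R] {l m n : Type*} [Fintype m]
    [DecidableEq m] [Fintype n] (A : Matrix l m R) (B : Matrix l n R)
    (h : LinearMap.range A.mulVecLin ≤ LinearMap.range B.mulVecLin) :
    ∃ X : Matrix n m R, A = B * X := by
  obtain ⟨X, hX⟩ := Module.projective_lifting_property B.mulVecLin.rangeRestrict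
    (A.mulVecLin.codRestrict _ fun x => h ⟨x, rfl⟩) B.mulVecLin.surjective_rangeRestrict
  refine ⟨LinearMap.toMatrix' X, Matrix.ext_of_mulVec_single fun i => ?_⟩
  have hi := congrArg Subtype.val (LinearMap.congr_fun hX (Pi.single i 1))
  rw [← mulVec_mulVec, LinearMap.toMatrix'_mulVec]
  exact hi.symm

variable {R : Type*} [CommRing R] {m n : Type*} [Fintype m] [DecidableEq m]
  [Fintype n] [DecidableEq n]

/-- The block matrices `[P, -G; 0, 1]` and `[1, 0; -F, Q]` have determinants `det P` and `det Q`,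
and the second one divides the first. -/
theorem det_dvd_det_of_mul_eq (P : Matrix m m R) (Q : Matrix n n R) {F : Matrix n m R}
    {G : Matrix m n R} {X : Matrix n m R} {T : Matrix n n R}
    (hX : F * P = Q * X) (hT : 1 - F * G = Q * T) : Q.det ∣ P.det := by
  have h : fromBlocks P (-G) 0 1 = fromBlocks 1 0 (-F) Q * fromBlocks P (-G) X T := by
    simp [fromBlocks_multiply, hX, ← hT]
  have hdet := congrArg det h
  rw [det_mul, det_fromBlocks_zero₂₁, det_fromBlocks_zero₁₂, det_one, det_one, mul_one,
    one_mul] at hdet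
  exact ⟨_, hdet⟩

theorem det_dvd_det_of_coker_equiv (P : Matrix m m R) (Q : Matrix n n R)
    (e : ((m → R) ⧸ LinearMap.range P.mulVecLin) ≃ₗ[R]
      ((n → R) ⧸ LinearMap.range Q.mulVecLin)) : Q.det ∣ P.det := by
  obtain ⟨f, hf⟩ := Module.projective_lifting_property (LinearMap.range Q.mulVecLin).mkQ
    (e.toLinearMap ∘ₗ (LinearMap.range P.mulVecLin).mkQ) (Submodule.mkQ_surjective _)
  obtain ⟨g, hg⟩ := Module.projective_lifting_property (LinearMap.range P.mulVecLin).mkQ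
    (e.symm.toLinearMap ∘ₗ (LinearMap.range Q.mulVecLin).mkQ) (Submodule.mkQ_surjective _)
  replace hf (x) : (LinearMap.range Q.mulVecLin).mkQ (f x) =
      e ((LinearMap.range P.mulVecLin).mkQ x) := LinearMap.congr_fun hf x
  replace hg (x) : (LinearMap.range P.mulVecLin).mkQ (g x) =
      e.symm ((LinearMap.range Q.mulVecLin).mkQ x) := LinearMap.congr_fun hg x
  obtain ⟨X, hX⟩ := exists_eq_mul_of_range_le (LinearMap.toMatrix' f * P) Q <| by
    rintro _ ⟨x, rfl⟩
    rw [mulVecLin_apply, ← mulVec_mulVec, LinearMap.toMatrix'_mulVec,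
      ← Submodule.Quotient.mk_eq_zero, ← Submodule.mkQ_apply, hf, Submodule.mkQ_apply,
      LinearEquiv.map_eq_zero_iff, Submodule.Quotient.mk_eq_zero]
    exact LinearMap.mem_range_self P.mulVecLin x
  obtain ⟨T, hT⟩ := exists_eq_mul_of_range_le
      (1 - LinearMap.toMatrix' f * LinearMap.toMatrix' g) Q <| by
    rintro _ ⟨x, rfl⟩
    rw [mulVecLin_apply, sub_mulVec, one_mulVec, ← mulVec_mulVec, LinearMap.toMatrix'_mulVec,
      LinearMap.toMatrix'_mulVec, ← Submodule.Quotient.mk_eq_zero, ← Submodule.mkQ_apply,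
      map_sub, hf, hg, LinearEquiv.apply_symm_apply, sub_self]
  exact det_dvd_det_of_mul_eq P Q hX hT

end Matrix

/-- Δ₀ is an invariant of the module: over a commutative ring, if two square matrices
have isomorphic cokernels, then their determinants generate the same principal ideal. -/
theorem span_det_eq_of_coker_equiv
    {R : Type*} [CommRing R] {a b : ℕ}
    (P : Matrix (Fin a) (Fin a) R) (Q : Matrix (Fin b) (Fin b) R)
    (h : Nonempty (((Fin a → R) ⧸ LinearMap.range P.mulVecLin) ≃ₗ[R]
          ((Fin b → R) ⧸ LinearMap.range Q.mulVecLin))) :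
    Ideal.span {P.det} = Ideal.span {Q.det} := by
  obtain ⟨e⟩ := h
  exact le_antisymm
    (Ideal.span_singleton_le_span_singleton.2 (Matrix.det_dvd_det_of_coker_equiv P Q e))
    (Ideal.span_singleton_le_span_singleton.2 (Matrix.det_dvd_det_of_coker_equiv Q P e.symm))
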